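/- Let n ≥ 1 be an integer and let K : [0,∞) → ℝ and f₁,…,f_n : ℝ → ℝ be n+1 continuous functions satisfying: (a) inf_{t>0} ∫₀ᵗ K(s)ds < 0 and liminf_{t→+∞} (∫₀ᵗ K(s)ds)/t > 0; (b) for each k = 1,…,n, limsup_{|t|→+∞} |∫₀ᵗ f_k(s)ds| / t² < +∞; (c) for each k = 1,…,n, the function t ↦ ∫₀ᵗ f_k(s)ds is odd and vanishes only at 0. Then, for each r > 0, there exists δ > 0 with the following property: for every n-tuple of continuous functions g₁,…,g_n : ℝ → ℝ satisfying max_{1≤k≤n} ( sup_{t∈ℝ} ∫₀ᵗ g_k(s)ds − inf_{t∈ℝ} ∫₀ᵗ g_k(s)ds ) < δ, there exists (μ̃₁,…,μ̃_n) ∈ ℝⁿ with Σ_{k=1}^n |μ̃_k|² < r², such that the problem −K(Σ_{h=1}^{n+1} |x_h − x_{h−1}|²)(x_{k+1} − 2x_k + x_{k−1}) = g_k(x_k) + μ̃_k f_k(x_k) for k = 1,…,n, with x₀ = x_{n+1} = 0, has at least three solutions. -/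

import Mathlib

open Filter

open Topology in
/-- Mountain pass theorem in finite dimension: a coercive `C¹` function with two global minima
has a third critical point. -/
theorem exists_third_critical_point {E : Type*} [NormedAddCommGroup E] [InnerProductSpace ℝ E]
    [ProperSpace E] {J : E → ℝ} {J' : E → E}
    (hJ : ∀ x, HasGradientAt J (J' x) x) (hJ' : Continuous J')
    (hcoer : Tendsto J (cocompact E) atTop) {p q : E} (hpq : p ≠ q)
    (hp : ∀ x, J p ≤ J x) (hq : ∀ x, J q ≤ J x) :
    ∃ z, z ≠ p ∧ z ≠ q ∧ J' z = 0 := by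
  by_contra! hcrit
  have hcont : Continuous J := continuous_iff_continuousAt.2 fun x => (hJ x).continuousAt
  have hmin : ∀ z, (∀ x, J z ≤ J x) → J' z = 0 := fun z hz => by
    have h := IsLocalMin.hasFDerivAt_eq_zero (Eventually.of_forall hz : IsLocalMin J z)
      (hJ z).hasFDerivAt
    simpa using h
  have hpq' : J q = J p := le_antisymm (hq p) (hp q)
  have hlt : ∀ z, z ≠ p → z ≠ q → J p < J z := fun z h1 h2 => by
    by_contra! h
    exact hcrit z h1 h2 (hmin z fun x => h.trans (hp x))
  have hsub : ∀ a, IsCompact {x | J x ≤ a} := fun a => by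
    obtain ⟨C, hC, h⟩ := mem_cocompact.1 (hcoer.eventually_gt_atTop a)
    refine hC.of_isClosed_subset (isClosed_le hcont continuous_const) fun x hx => ?_
    by_contra hxC
    have h1 : a < J x := h hxC
    exact absurd h1 (not_lt.2 hx)
  have hd : 0 < dist p q := dist_pos.2 hpq
  -- a sphere separating `p` from `q`, on which `J` is bounded away from its minimum
  obtain ⟨c₀, hc₀, hsphere⟩ : ∃ c₀, J p < c₀ ∧ ∀ x ∈ Metric.sphere p (dist p q / 2), c₀ ≤ J x := by
    have hne : (Metric.sphere p (dist p q / 2)).Nonempty := by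
      refine ⟨midpoint ℝ p q, ?_⟩
      rw [Metric.mem_sphere, dist_midpoint_left]
      norm_num
      ring
    obtain ⟨z, hz, hzmin⟩ := (isCompact_sphere p (dist p q / 2)).exists_isMinOn hne
      hcont.continuousOn
    refine ⟨J z, hlt z ?_ ?_, fun x hx => hzmin hx⟩
    · rintro rfl
      rw [Metric.mem_sphere, dist_self] at hz
      linarith
    · rintro rfl
      rw [Metric.mem_sphere, dist_comm] at hz
      linarith
  set A : Set ℝ := {a | ∃ S : Set E, IsPreconnected S ∧ p ∈ S ∧ q ∈ S ∧ ∀ x ∈ S, J x ≤ a}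
  have hAne : A.Nonempty := by
    have hcpt : IsCompact (segment ℝ p q) := by
      rw [segment_eq_image_lineMap]
      exact isCompact_Icc.image AffineMap.lineMap_continuous
    obtain ⟨a, ha⟩ := (hcpt.image hcont).bddAbove
    exact ⟨a, segment ℝ p q, (convex_segment p q).isPreconnected, left_mem_segment ℝ p q,
      right_mem_segment ℝ p q, fun x hx => ha ⟨x, hx, rfl⟩⟩
  have hAlb : ∀ a ∈ A, c₀ ≤ a := by
    rintro a ⟨S, hS, hpS, hqS, hSa⟩
    have h := hS.intermediate_value hpS hqS (f := fun x => dist x p) (by fun_prop)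
    obtain ⟨x, hxS, hx⟩ := h (show dist p q / 2 ∈ _ by
      rw [Set.mem_Icc, dist_self, dist_comm q p]; constructor <;> linarith)
    exact (hsphere x hx).trans (hSa x hxS)
  have hAbdd : BddBelow A := ⟨c₀, hAlb⟩
  set c := sInf A
  have hcp : J p < c := hc₀.trans_le (le_csInf hAne hAlb)
  obtain ⟨η, hη, hηN⟩ : ∃ η > 0, ∀ x, (c + J p) / 2 ≤ J x → J x ≤ c + 1 → η ≤ ‖J' x‖ := by
    have hcpt : IsCompact ({x | J x ≤ c + 1} ∩ {x | (c + J p) / 2 ≤ J x}) :=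
      (hsub _).inter_right (isClosed_le continuous_const hcont)
    rcases Set.eq_empty_or_nonempty ({x | J x ≤ c + 1} ∩ {x | (c + J p) / 2 ≤ J x}) with h | h
    · refine ⟨1, one_pos, fun x h1 h2 => ?_⟩
      exact absurd (Set.mem_inter (a := {x | J x ≤ c + 1}) h2 h1) (h ▸ Set.notMem_empty x)
    · obtain ⟨z, hz, hzmin⟩ := hcpt.exists_isMinOn h hJ'.norm.continuousOn
      refine ⟨‖J' z‖, norm_pos_iff.2 fun h0 => ?_, fun x h1 h2 => hzmin ⟨h2, h1⟩⟩
      have hz2 : (c + J p) / 2 ≤ J z := hz.2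
      by_cases hzp : z = p
      · subst hzp; linarith
      · by_cases hzq : z = q
        · subst hzq; linarith
        · exact hcrit z hzp hzq h0
  obtain ⟨R, hR⟩ : ∃ R, ∀ x, J x ≤ c + 1 → ‖J' x‖ ≤ R := by
    obtain ⟨R, hR⟩ := ((hsub (c + 1)).image hJ'.norm).bddAbove
    exact ⟨R, fun x hx => hR ⟨x, hx, rfl⟩⟩
  obtain ⟨τ, hτ, hunif⟩ : ∃ τ > 0, ∀ x y, J x ≤ c + 1 → dist x y < τ →
      dist (J' x) (J' y) < η / 2 := by
    have h := (hsub (c + 1)).uniformContinuousAt_of_continuousAt J'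
      (fun x _ => hJ'.continuousAt) (Metric.dist_mem_uniformity (half_pos hη))
    obtain ⟨τ, hτ, h⟩ := Metric.mem_uniformity_dist.1 h
    exact ⟨τ, hτ, fun x y hx hxy => h hxy hx⟩
  obtain ⟨t, ht, htR, htη, htη1⟩ : ∃ t > 0, t * R < τ ∧ t * η ^ 2 / 2 ≤ (c - J p) / 4 ∧
      t * η ^ 2 / 2 ≤ 1 / 2 := by
    have h1 : Tendsto (fun t : ℝ => t * R) (𝓝[>] 0) (𝓝 0) := by
      refine tendsto_nhdsWithin_of_tendsto_nhds ?_
      exact Continuous.tendsto' (by fun_prop) _ _ (by simp)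
    have h2 : Tendsto (fun t : ℝ => t * η ^ 2 / 2) (𝓝[>] 0) (𝓝 0) := by
      refine tendsto_nhdsWithin_of_tendsto_nhds ?_
      exact Continuous.tendsto' (by fun_prop) _ _ (by simp)
    have h0 : ∀ᶠ t : ℝ in 𝓝[>] 0, 0 < t := self_mem_nhdsWithin
    exact (h0.and ((h1.eventually_lt_const hτ).and
      ((h2.eventually_le_const (by linarith)).and
        (h2.eventually_le_const (by norm_num))))).exists
  -- one step of gradient descent
  have hstep : ∀ x, J x ≤ c + 1 →
      J (x - t • J' x) ≤ J x - t * ‖J' x‖ ^ 2 + t * (‖J' x‖ * (η / 2)) := by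
    intro x hx
    have hder : ∀ s : ℝ, HasDerivAt (fun s : ℝ => J (x - s • J' x))
        (-inner ℝ (J' (x - s • J' x)) (J' x)) s := by
      intro s
      have h1 : HasDerivAt (fun s : ℝ => x - s • J' x) (-J' x) s := by
        simpa using ((hasDerivAt_id s).smul_const (J' x)).const_sub x
      have h2 := (hJ (x - s • J' x)).hasFDerivAt.comp_hasDerivAt s h1
      rwa [InnerProductSpace.toDual_apply_apply, inner_neg_right] at h2
    obtain ⟨s, hs, hs'⟩ := exists_hasDerivAt_eq_slope _ _ ht
      (fun s _ => (hder s).continuousAt.continuousWithinAt) (fun s _ => hder s)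
    have hclose : ‖J' x - J' (x - s • J' x)‖ < η / 2 := by
      rw [← dist_eq_norm]
      apply hunif x _ hx
      rw [dist_eq_norm, sub_sub_cancel, norm_smul, Real.norm_of_nonneg hs.1.le]
      calc s * ‖J' x‖ ≤ t * R := by
            have := hR x hx
            have := norm_nonneg (J' x)
            exact mul_le_mul hs.2.le (hR x hx) this ht.le
        _ < τ := htR
    have h3 : inner ℝ (J' x - J' (x - s • J' x)) (J' x) ≤ ‖J' x‖ * (η / 2) := by
      refine (real_inner_le_norm _ _).trans ?_
      rw [mul_comm]
      gcongr
    rw [inner_sub_left, real_inner_self_eq_norm_sq] at h3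
    rw [zero_smul, sub_zero, sub_zero, eq_div_iff ht.ne'] at hs'
    nlinarith
  have hκ : 0 < t * η ^ 2 / 2 := by positivity
  obtain ⟨a, ⟨S, hS, hpS, hqS, hSa⟩, hac⟩ := exists_lt_of_csInf_lt hAne
    (show sInf A < c + t * η ^ 2 / 2 by linarith)
  have hmem : max a c - t * η ^ 2 / 2 ∈ A := by
    refine ⟨(fun x => x - t • J' x) '' S, hS.image _ (by fun_prop), ⟨p, hpS, ?_⟩, ⟨q, hqS, ?_⟩, ?_⟩
    · simp [hmin p hp]
    · simp [hmin q hq]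
    · rintro _ ⟨x, hx, rfl⟩
      have hxa := hSa x hx
      have hst := hstep x (by linarith)
      have hm1 := le_max_left a c
      have hm2 := le_max_right a c
      by_cases hN : (c + J p) / 2 ≤ J x
      · have h1 := hηN x hN (by linarith)
        have h2 : ‖J' x‖ * (η / 2) ≤ ‖J' x‖ ^ 2 / 2 := by nlinarith
        have h3 : η ^ 2 ≤ ‖J' x‖ ^ 2 := by gcongr
        have h4 := mul_le_mul_of_nonneg_left h2 ht.le
        have h5 := mul_le_mul_of_nonneg_left h3 ht.le
        dsimp only
        linarith
      · push Not at hN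
        have h2 : - ‖J' x‖ ^ 2 + ‖J' x‖ * (η / 2) ≤ η ^ 2 / 2 := by
          nlinarith [sq_nonneg (‖J' x‖ - η / 4)]
        have h4 := mul_le_mul_of_nonneg_left h2 ht.le
        dsimp only
        linarith
  have := csInf_le hAbdd hmem
  have h6 : max a c - t * η ^ 2 / 2 < c := by
    rw [sub_lt_iff_lt_add]
    exact max_lt hac (by linarith)
  linarith

/-- If the maximum over a ball of `μ ↦ inf (I - ∑ μ k * Φ k)` is not attained on the boundary and
no minimizer is a zero of `Φ`, then some `μ` in the ball admits two distinct minimizers. -/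
theorem exists_two_minimizers {X ι : Type*} [PseudoMetricSpace X] [Fintype ι] {I : X → ℝ}
    {Φ : ι → X → ℝ} (hI : Continuous I) (hΦ : ∀ k, Continuous (Φ k)) {ρ : ℝ} (hρ : 0 < ρ)
    {C : Set X} (hC : IsCompact C) {x₀ : X} (hx₀ : x₀ ∈ C)
    (hout : ∀ μ : ι → ℝ, ‖μ‖ ≤ ρ → ∀ x ∉ C,
      I x₀ - ∑ k, μ k * Φ k x₀ < I x - ∑ k, μ k * Φ k x)
    (hbdry : ∀ μ : ι → ℝ, ‖μ‖ = ρ → ∃ x, ∀ y, I x - ∑ k, μ k * Φ k x < I y)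
    (hzero : ∀ μ : ι → ℝ, ‖μ‖ ≤ ρ → ∀ z, (∀ k, Φ k z = 0) →
      ∃ y, I y - ∑ k, μ k * Φ k y < I z - ∑ k, μ k * Φ k z) :
    ∃ μ : ι → ℝ, ‖μ‖ < ρ ∧ ∃ p q, p ≠ q ∧
      (∀ x, I p - ∑ k, μ k * Φ k p ≤ I x - ∑ k, μ k * Φ k x) ∧
      (∀ x, I q - ∑ k, μ k * Φ k q ≤ I x - ∑ k, μ k * Φ k x) := by
  set P : (ι → ℝ) → X → ℝ := fun μ x => I x - ∑ k, μ k * Φ k x with hP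
  have hPc : Continuous fun z : (ι → ℝ) × X => P z.1 z.2 := by
    simp only [hP]; fun_prop
  have hex : ∀ μ : ι → ℝ, ∃ x, ‖μ‖ ≤ ρ → x ∈ C ∧ ∀ y, P μ x ≤ P μ y := by
    intro μ
    obtain ⟨x, hxC, hx⟩ := hC.exists_isMinOn ⟨x₀, hx₀⟩
      (hPc.comp (Continuous.prodMk_right μ)).continuousOn
    refine ⟨x, fun hμ => ⟨hxC, fun y => ?_⟩⟩
    by_cases hy : y ∈ C
    · exact hx hy
    · exact (hx hx₀ : P μ x ≤ P μ x₀).trans (hout μ hμ y hy).le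
  choose ξ hξ using hex
  have husc : UpperSemicontinuousOn (fun μ => P μ (ξ μ)) (Metric.closedBall (0 : ι → ℝ) ρ) := by
    intro μ hμ y hy
    have h1 : ∀ᶠ ν in nhdsWithin μ (Metric.closedBall (0 : ι → ℝ) ρ), P ν (ξ μ) < y :=
      ((hPc.comp (Continuous.prodMk_left (ξ μ))).continuousWithinAt.eventually_lt_const hy)
    filter_upwards [h1, self_mem_nhdsWithin] with ν hν hν'
    exact ((hξ ν (by simpa using hν')).2 _).trans_lt hν
  obtain ⟨μ, hμ, hmax⟩ := husc.exists_isMaxOn ⟨0, by simpa using hρ.le⟩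
    (isCompact_closedBall (0 : ι → ℝ) ρ)
  have hμρ : ‖μ‖ ≤ ρ := by simpa using hμ
  have hmax' : ∀ ν : ι → ℝ, ‖ν‖ ≤ ρ → P ν (ξ ν) ≤ P μ (ξ μ) := fun ν hν =>
    hmax (show ν ∈ Metric.closedBall (0 : ι → ℝ) ρ by simpa using hν)
  have hμlt : ‖μ‖ < ρ := by
    refine lt_of_le_of_ne hμρ fun h => ?_
    obtain ⟨x, hx⟩ := hbdry μ h
    have h1 := hmax' 0 (by simpa using hρ.le)
    have h2 := (hξ μ hμρ).2 x
    have h3 : P μ x < I (ξ 0) := hx _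
    have h4 : P 0 (ξ 0) = I (ξ 0) := by simp [hP]
    linarith
  refine ⟨μ, hμlt, ?_⟩
  by_contra! huniq
  have huniq' : ∀ y, (∀ x, P μ y ≤ P μ x) → y = ξ μ := by
    intro y hy
    by_contra hne
    obtain ⟨x, hx⟩ := huniq y (ξ μ) hne hy
    exact absurd ((hξ μ hμρ).2 x) (not_le.2 hx)
  set w : ι → ℝ := fun k => Φ k (ξ μ)
  set ν : ℕ → ι → ℝ := fun j => μ - (1 / ((j : ℝ) + 1)) • w with hν
  have hνlim : Tendsto ν atTop (nhds μ) := by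
    have h := (tendsto_one_div_add_atTop_nhds_zero_nat (𝕜 := ℝ)).smul_const w
    simpa [hν] using h.const_sub μ
  obtain ⟨N, hN⟩ := eventually_atTop.1 (hνlim.norm.eventually_le_const hμlt)
  have hνlim' : Tendsto (fun j => ν (j + N)) atTop (nhds μ) :=
    hνlim.comp (tendsto_add_atTop_nat N)
  obtain ⟨y, -, φ, hφ, hlim⟩ := hC.tendsto_subseq
    (x := fun j => ξ (ν (j + N))) fun j => (hξ _ (hN _ (by omega))).1
  have hlim2 := (hνlim'.comp hφ.tendsto_atTop).prodMk_nhds hlim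
  have hy : y = ξ μ := by
    refine huniq' y fun x => ?_
    refine le_of_tendsto_of_tendsto' ((hPc.tendsto (μ, y)).comp hlim2)
      (((hPc.comp (Continuous.prodMk_left x)).tendsto μ).comp
        (hνlim'.comp hφ.tendsto_atTop)) fun j => ?_
    exact (hξ _ (hN _ (by omega))).2 x
  have hsign : ∀ j, ∑ k, w k * Φ k (ξ (ν (j + N))) ≤ 0 := by
    intro j
    have h1 := hmax' _ (hN (j + N) (by omega))
    have h2 := (hξ μ hμρ).2 (ξ (ν (j + N)))
    have h3 := h1.trans h2
    have h4 : (0 : ℝ) < 1 / (((j + N : ℕ) : ℝ) + 1) := by positivity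
    generalize ξ (ν (j + N)) = x at h3 ⊢
    simp only [hP, hν, Pi.sub_apply, Pi.smul_apply, smul_eq_mul, sub_mul,
      Finset.sum_sub_distrib, mul_assoc, ← Finset.mul_sum] at h3
    by_contra! h5
    have := mul_pos h4 h5
    linarith
  have hsum : ∑ k, w k * Φ k y ≤ 0 := by
    have hc : Continuous fun x => ∑ k, w k * Φ k x := by fun_prop
    exact le_of_tendsto' ((hc.tendsto y).comp hlim) fun j => hsign _
  rw [hy] at hsum
  have hw0 : ∀ k, Φ k (ξ μ) = 0 := by
    have h := (Finset.sum_eq_zero_iff_of_nonneg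
      (fun k _ => mul_self_nonneg (Φ k (ξ μ)))).1
      (le_antisymm hsum (Finset.sum_nonneg fun k _ => mul_self_nonneg (Φ k (ξ μ))))
    exact fun k => mul_self_eq_zero.1 (h k (Finset.mem_univ k))
  obtain ⟨x, hx⟩ := hzero μ hμρ _ hw0
  exact absurd ((hξ μ hμρ).2 x) (not_le.2 hx)

/-- Extension of a vector of interior values by zero at both end points. -/
def zeroExtend (n : ℕ) : EuclideanSpace ℝ (Fin n) →ₗ[ℝ] (Fin (n + 2) → ℝ) where
  toFun x := Fin.cons 0 (Fin.snoc (α := fun _ => ℝ) (fun k => x k) 0 : Fin (n + 1) → ℝ)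
  map_add' x y := by
    ext i
    refine Fin.cases ?_ (fun j => ?_) i
    · simp
    · refine Fin.lastCases ?_ (fun k => ?_) j <;> simp
  map_smul' c x := by
    ext i
    refine Fin.cases ?_ (fun j => ?_) i
    · simp
    · refine Fin.lastCases ?_ (fun k => ?_) j <;> simp

@[simp] theorem zeroExtend_zero (n : ℕ) (x : EuclideanSpace ℝ (Fin n)) : zeroExtend n x 0 = 0 := by
  simp [zeroExtend]

@[simp] theorem zeroExtend_last (n : ℕ) (x : EuclideanSpace ℝ (Fin n)) :
    zeroExtend n x (Fin.last (n + 1)) = 0 := by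
  simp [zeroExtend, ← Fin.succ_last]

@[simp] theorem zeroExtend_castSucc_succ (n : ℕ) (x : EuclideanSpace ℝ (Fin n)) (k : Fin n) :
    zeroExtend n x k.castSucc.succ = x k := by
  simp [zeroExtend]

theorem zeroExtend_succ_castSucc (n : ℕ) (x : EuclideanSpace ℝ (Fin n)) (k : Fin n) :
    zeroExtend n x k.succ.castSucc = x k := by
  simp

theorem zeroExtend_injective (n : ℕ) : Function.Injective (zeroExtend n) := fun x y h => by
  ext k
  simpa using congrFun h k.castSucc.succ

/-- The forward difference of the extended vector, as a continuous linear functional. -/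
noncomputable def forwardDiff (n : ℕ) (h : Fin (n + 1)) : EuclideanSpace ℝ (Fin n) →L[ℝ] ℝ :=
  LinearMap.toContinuousLinearMap
    ((LinearMap.proj (R := ℝ) (φ := fun _ => ℝ) h.succ - LinearMap.proj h.castSucc) ∘ₗ zeroExtend n)

theorem forwardDiff_apply (n : ℕ) (h : Fin (n + 1)) (x : EuclideanSpace ℝ (Fin n)) :
    forwardDiff n h x = zeroExtend n x h.succ - zeroExtend n x h.castSucc := by
  simp [forwardDiff]

/-- The squared norm `∑ |x_h - x_{h-1}|²`. -/
noncomputable def gradientEnergy (n : ℕ) (x : EuclideanSpace ℝ (Fin n)) : ℝ :=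
  ∑ h, forwardDiff n h x ^ 2

theorem gradientEnergy_nonneg (n : ℕ) (x : EuclideanSpace ℝ (Fin n)) : 0 ≤ gradientEnergy n x :=
  Finset.sum_nonneg fun _ _ => sq_nonneg _

theorem gradientEnergy_smul (n : ℕ) (c : ℝ) (x : EuclideanSpace ℝ (Fin n)) :
    gradientEnergy n (c • x) = c ^ 2 * gradientEnergy n x := by
  simp [gradientEnergy, mul_pow, Finset.mul_sum]

theorem continuous_gradientEnergy (n : ℕ) : Continuous (gradientEnergy n) := by
  unfold gradientEnergy
  fun_prop

/-- Summation by parts. -/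
theorem sum_forwardDiff_mul (n : ℕ) (x v : EuclideanSpace ℝ (Fin n)) :
    ∑ h, forwardDiff n h x * forwardDiff n h v =
      ∑ k : Fin n, -(zeroExtend n x k.succ.succ - 2 * zeroExtend n x k.succ.castSucc
        + zeroExtend n x k.castSucc.castSucc) * v k := by
  have h1 : ∑ h, forwardDiff n h x * zeroExtend n v h.succ =
      ∑ k : Fin n, forwardDiff n k.castSucc x * v k := by
    rw [Fin.sum_univ_castSucc]
    simp
  have h2 : ∑ h, forwardDiff n h x * zeroExtend n v h.castSucc =
      ∑ k : Fin n, forwardDiff n k.succ x * v k := by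
    rw [Fin.sum_univ_succ]
    simp
  calc ∑ h, forwardDiff n h x * forwardDiff n h v
      = ∑ h, forwardDiff n h x * zeroExtend n v h.succ
        - ∑ h, forwardDiff n h x * zeroExtend n v h.castSucc := by
        rw [← Finset.sum_sub_distrib]
        exact Finset.sum_congr rfl fun h _ => by rw [forwardDiff_apply n h v]; ring
    _ = _ := by
        rw [h1, h2, ← Finset.sum_sub_distrib]
        refine Finset.sum_congr rfl fun k _ => ?_
        rw [forwardDiff_apply, forwardDiff_apply, Fin.succ_castSucc]
        ring

/-- A discrete Poincaré inequality. -/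
theorem norm_sq_le_gradientEnergy (n : ℕ) (x : EuclideanSpace ℝ (Fin n)) :
    ‖x‖ ^ 2 ≤ n * (n + 2) ^ 2 * gradientEnergy n x := by
  set N := Real.sqrt (gradientEnergy n x) with hN
  have hN2 : N ^ 2 = gradientEnergy n x := Real.sq_sqrt (gradientEnergy_nonneg n x)
  have hstep : ∀ h, |forwardDiff n h x| ≤ N := fun h => by
    refine Real.abs_le_sqrt ?_
    exact Finset.single_le_sum (f := fun h => forwardDiff n h x ^ 2)
      (fun _ _ => sq_nonneg _) (Finset.mem_univ h)
  have hind : ∀ i : Fin (n + 2), |zeroExtend n x i| ≤ (i : ℕ) * N := by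
    intro i
    induction i using Fin.induction with
    | zero => simp
    | succ h ih =>
      have h1 := hstep h
      rw [forwardDiff_apply] at h1
      have h2 := abs_add_le (zeroExtend n x h.succ - zeroExtend n x h.castSucc)
        (zeroExtend n x h.castSucc)
      rw [sub_add_cancel] at h2
      rw [Fin.val_castSucc] at ih
      rw [Fin.val_succ]
      push_cast
      linarith
  have hcoord : ∀ k, ‖x k‖ ^ 2 ≤ (n + 2) ^ 2 * gradientEnergy n x := by
    intro k
    have h1 := hind k.succ.castSucc
    rw [zeroExtend_succ_castSucc] at h1
    have h2 : ((k.succ.castSucc : ℕ) : ℝ) ≤ n + 2 := by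
      exact_mod_cast k.succ.castSucc.2.le
    have h3 : |x k| ≤ (n + 2) * N := h1.trans (by gcongr)
    rw [← hN2, ← mul_pow, Real.norm_eq_abs]
    gcongr
  rw [EuclideanSpace.norm_sq_eq]
  refine (Finset.sum_le_sum fun k _ => hcoord k).trans_eq ?_
  simp [mul_assoc]

/-- The energy functional of the discrete problem is differentiable, and its gradient is the
difference of the two sides of the equation. -/
theorem hasGradientAt_energy (n : ℕ) {K : ℝ → ℝ} {f : Fin n → ℝ → ℝ} (hK : Continuous K)
    (hf : ∀ k, Continuous (f k)) (x : EuclideanSpace ℝ (Fin n)) :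
    HasGradientAt (fun x : EuclideanSpace ℝ (Fin n) =>
        (∫ s in (0 : ℝ)..gradientEnergy n x, K s) / 2 - ∑ k, ∫ s in (0 : ℝ)..x k, f k s)
      (WithLp.toLp 2 fun k => -(K (gradientEnergy n x) * (zeroExtend n x k.succ.succ
        - 2 * zeroExtend n x k.succ.castSucc + zeroExtend n x k.castSucc.castSucc)) - f k (x k))
      x := by
  have hE : HasFDerivAt (gradientEnergy n)
      (∑ h, (2 * forwardDiff n h x) • forwardDiff n h) x := by
    have h : ∀ h ∈ Finset.univ, HasFDerivAt (fun x => forwardDiff n h x ^ 2)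
        ((2 * forwardDiff n h x) • forwardDiff n h) x := fun h _ => by
      simpa using (forwardDiff n h).hasFDerivAt.pow 2 (x := x)
    exact HasFDerivAt.fun_sum h
  have h1 := (((intervalIntegral.integral_hasDerivAt_right (hK.intervalIntegrable 0 _)
    (hK.stronglyMeasurableAtFilter _ _) hK.continuousAt).div_const 2).comp_hasFDerivAt x hE)
  have h2 : ∀ k ∈ (Finset.univ : Finset (Fin n)),
      HasFDerivAt (fun x : EuclideanSpace ℝ (Fin n) => ∫ s in (0 : ℝ)..x k, f k s)
        (f k (x k) • (EuclideanSpace.proj k : EuclideanSpace ℝ (Fin n) →L[ℝ] ℝ)) x := fun k _ =>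
    (intervalIntegral.integral_hasDerivAt_right ((hf k).intervalIntegrable 0 _)
      ((hf k).stronglyMeasurableAtFilter _ _) (hf k).continuousAt).comp_hasFDerivAt x
        (EuclideanSpace.proj k : EuclideanSpace ℝ (Fin n) →L[ℝ] ℝ).hasFDerivAt
  rw [hasGradientAt_iff_hasFDerivAt]
  refine (h1.sub (HasFDerivAt.fun_sum h2)).congr_fderiv ?_
  ext v
  have h3 := sum_forwardDiff_mul n x v
  simp only [InnerProductSpace.toDual_apply_apply, PiLp.inner_apply]
  simp only [sub_apply, smul_apply, sum_apply, smul_eq_mul, mul_assoc, ← Finset.mul_sum, h3]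
  simp only [Finset.mul_sum, PiLp.proj_apply, RCLike.inner_apply, conj_trivial]
  rw [← Finset.sum_sub_distrib]
  refine Finset.sum_congr rfl fun k _ => ?_
  ring

theorem continuous_gradient_energy (n : ℕ) {K : ℝ → ℝ} {f : Fin n → ℝ → ℝ} (hK : Continuous K)
    (hf : ∀ k, Continuous (f k)) :
    Continuous fun x : EuclideanSpace ℝ (Fin n) => WithLp.toLp 2 fun k =>
      -(K (gradientEnergy n x) * (zeroExtend n x k.succ.succ
        - 2 * zeroExtend n x k.succ.castSucc + zeroExtend n x k.castSucc.castSucc))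
        - f k (x k) := by
  have h1 : Continuous (zeroExtend n) := LinearMap.continuous_of_finiteDimensional _
  have h2 : ∀ i, Continuous fun x => zeroExtend n x i := fun i => (continuous_apply i).comp h1
  have h3 := continuous_gradientEnergy n
  refine (PiLp.continuous_toLp 2 _).comp (continuous_pi fun k => ?_)
  have h4 : Continuous fun x : EuclideanSpace ℝ (Fin n) => f k (x k) := by
    have := hf k
    fun_prop
  have h5 := hK.comp h3
  exact (((h5.mul (((h2 _).sub ((h2 _).const_mul 2)).add (h2 _))).neg).sub h4)

theorem exists_linear_lower_bound {F : ℝ → ℝ} (hF : Continuous F)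
    (h : 0 < liminf (fun t : ℝ => ((F t / t : ℝ) : EReal)) atTop) :
    ∃ c > 0, ∃ b, ∀ t ≥ 0, c * t - b ≤ F t := by
  obtain ⟨c, hc, hcl⟩ := EReal.lt_iff_exists_real_btwn.1 h
  have hev := eventually_lt_of_lt_liminf hcl
  obtain ⟨T, hT⟩ := eventually_atTop.1 (hev.and (eventually_gt_atTop 0))
  obtain ⟨b, hb⟩ := ((isCompact_Icc (a := 0) (b := T)).image
    (show Continuous fun t => c * t - F t by fun_prop)).bddAbove
  refine ⟨c, by exact_mod_cast hc, max b 0, fun t ht => ?_⟩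
  rcases le_total t T with htT | htT
  · have := hb ⟨t, ⟨ht, htT⟩, rfl⟩
    have := le_max_left b 0
    dsimp only at *
    linarith
  · obtain ⟨h1, h2⟩ := hT t htT
    have h3 : c < F t / t := by exact_mod_cast h1
    rw [lt_div_iff₀ h2] at h3
    have := le_max_right b 0
    linarith

theorem exists_quadratic_upper_bound {F : ℝ → ℝ} (hF : Continuous F)
    (h : limsup (fun t : ℝ => ((|F t| / t ^ 2 : ℝ) : EReal)) (atBot ⊔ atTop) < ⊤) :
    ∃ a ≥ 0, ∃ b, ∀ t, |F t| ≤ a * t ^ 2 + b := by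
  obtain ⟨a, hal, -⟩ := EReal.lt_iff_exists_real_btwn.1 h
  have hev := eventually_lt_of_limsup_lt hal
  rw [eventually_sup] at hev
  obtain ⟨T₁, hT₁⟩ := eventually_atBot.1 (hev.1.and (eventually_lt_atBot 0))
  obtain ⟨T₂, hT₂⟩ := eventually_atTop.1 (hev.2.and (eventually_gt_atTop 0))
  obtain ⟨b, hb⟩ := ((isCompact_Icc (a := T₁) (b := T₂)).image hF.abs).bddAbove
  have hout : ∀ t, ((|F t| / t ^ 2 : ℝ) : EReal) < a → t ≠ 0 →
      |F t| ≤ max a 0 * t ^ 2 + max b 0 := by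
    intro t h1 h2
    have h3 : |F t| / t ^ 2 < a := by exact_mod_cast h1
    rw [div_lt_iff₀ (by positivity)] at h3
    have h4 := mul_le_mul_of_nonneg_right (le_max_left a 0) (sq_nonneg t)
    have := le_max_right b 0
    linarith
  refine ⟨max a 0, le_max_right _ _, max b 0, fun t => ?_⟩
  rcases le_total t T₁ with h1 | h1
  · exact hout t (hT₁ t h1).1 (hT₁ t h1).2.ne
  · rcases le_total t T₂ with h2 | h2
    · have h3 : |F t| ≤ b := hb ⟨t, ⟨h1, h2⟩, rfl⟩
      have := le_max_left b 0
      have : 0 ≤ max a 0 * t ^ 2 := mul_nonneg (le_max_right _ _) (sq_nonneg t)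
      linarith
    · exact hout t (hT₂ t h2).1 (hT₂ t h2).2.ne'

theorem exists_min_on_nonneg {F : ℝ → ℝ} (hF : Continuous F) (h0 : F 0 = 0) {t₁ : ℝ}
    (ht₁ : 0 < t₁) (hneg : F t₁ < 0) {c b : ℝ} (hc : 0 < c) (hlow : ∀ t ≥ 0, c * t - b ≤ F t) :
    ∃ t₀ > 0, F t₀ < 0 ∧ ∀ t ≥ 0, F t₀ ≤ F t := by
  have hmem : t₁ ∈ Set.Icc 0 (max t₁ (b / c)) := ⟨ht₁.le, le_max_left _ _⟩
  obtain ⟨t₀, ht₀, hmin⟩ := isCompact_Icc.exists_isMinOn ⟨t₁, hmem⟩ hF.continuousOn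
  have h1 : F t₀ < 0 := (hmin hmem : F t₀ ≤ F t₁).trans_lt hneg
  refine ⟨t₀, lt_of_le_of_ne ht₀.1 ?_, h1, fun t ht => ?_⟩
  · rintro rfl
    exact h1.ne h0
  · rcases le_total t (max t₁ (b / c)) with h | h
    · exact hmin (show t ∈ Set.Icc _ _ from ⟨ht, h⟩)
    · have h2 : b / c ≤ t := (le_max_right _ _).trans h
      rw [div_le_iff₀ hc] at h2
      have := hlow t ht
      linarith

theorem exists_uniform_quadratic_upper_bound {ι : Type*} [Fintype ι] {F : ι → ℝ → ℝ}
    (hF : ∀ k, Continuous (F k))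
    (h : ∀ k, limsup (fun t : ℝ => ((|F k t| / t ^ 2 : ℝ) : EReal)) (atBot ⊔ atTop) < ⊤) :
    ∃ a ≥ 0, ∃ b ≥ 0, ∀ k t, |F k t| ≤ a * t ^ 2 + b := by
  choose a ha b hab using fun k => exists_quadratic_upper_bound (hF k) (h k)
  have hb : ∀ k, 0 ≤ b k := fun k => by
    have := (abs_nonneg _).trans (hab k 0)
    simpa using this
  refine ⟨∑ k, a k, Finset.sum_nonneg fun k _ => ha k, ∑ k, b k,
    Finset.sum_nonneg fun k _ => hb k, fun k t => (hab k t).trans ?_⟩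
  have h1 := Finset.single_le_sum (f := a) (fun k _ => ha k) (Finset.mem_univ k)
  have h2 := Finset.single_le_sum (f := b) (fun k _ => hb k) (Finset.mem_univ k)
  have := mul_le_mul_of_nonneg_right h1 (sq_nonneg t)
  linarith

/-- A coordinate vector of prescribed energy. -/
theorem exists_single_gradientEnergy_eq (n : ℕ) (k : Fin n) {t : ℝ} (ht : 0 < t) :
    ∃ s > 0, gradientEnergy n (EuclideanSpace.single k s) = t ∧
      gradientEnergy n (EuclideanSpace.single k (-s)) = t := by
  set E := gradientEnergy n (EuclideanSpace.single k 1) with hE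
  have hE0 : 0 < E := by
    refine lt_of_le_of_ne (gradientEnergy_nonneg n _) fun h => ?_
    have h1 := norm_sq_le_gradientEnergy n (EuclideanSpace.single k 1)
    rw [← hE, ← h] at h1
    norm_num at h1
  have hs : ∀ s : ℝ, gradientEnergy n (EuclideanSpace.single k s) = s ^ 2 * E := fun s => by
    rw [hE, ← gradientEnergy_smul]
    congr 1
    ext j
    simp
  refine ⟨Real.sqrt (t / E), by positivity, ?_, ?_⟩
  · rw [hs, Real.sq_sqrt (by positivity)]
    field_simp
  · rw [hs, neg_sq, Real.sq_sqrt (by positivity)]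
    field_simp

/-- For small multipliers the perturbed energy is coercive, uniformly in the multiplier. -/
theorem exists_coercive_bound (n : ℕ) {Kint : ℝ → ℝ} {F G : Fin n → ℝ → ℝ} {c b A B ρ : ℝ}
    (hc : 0 < c) (hlow : ∀ t ≥ 0, c * t - b ≤ Kint t)
    (hF : ∀ k t, |F k t| ≤ A * t ^ 2 + B) (hρ : ρ * A * (n * (n + 2) ^ 2 + 1) ≤ c / 4)
    {M : Fin n → ℝ} (hG : ∀ k t, G k t ≤ M k) :
    ∃ a > 0, ∃ d, ∀ μ : Fin n → ℝ, ‖μ‖ ≤ ρ → ∀ x : EuclideanSpace ℝ (Fin n),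
      a * ‖x‖ ^ 2 - d ≤ Kint (gradientEnergy n x) / 2 - ∑ k, G k (x k)
        - ∑ k, μ k * F k (x k) := by
  set Λ : ℝ := n * (n + 2) ^ 2 + 1 with hΛ
  have hΛ0 : 0 < Λ := by positivity
  refine ⟨c / (4 * Λ), by positivity, b / 2 + ∑ k, M k + n * (ρ * B), fun μ hμ x => ?_⟩
  have hρ0 : 0 ≤ ρ := (norm_nonneg _).trans hμ
  have hE0 := gradientEnergy_nonneg n x
  have h1 := hlow _ hE0
  have h2 : ∑ k, G k (x k) ≤ ∑ k, M k := Finset.sum_le_sum fun k _ => hG k _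
  have h3 : ∑ k, μ k * F k (x k) ≤ ∑ k, (ρ * A * ‖x k‖ ^ 2 + ρ * B) := by
    refine Finset.sum_le_sum fun k _ => ?_
    calc μ k * F k (x k) ≤ |μ k| * |F k (x k)| := by
          rw [← abs_mul]; exact le_abs_self _
      _ ≤ ρ * (A * x k ^ 2 + B) :=
          mul_le_mul ((norm_le_pi_norm μ k).trans hμ) (hF k _) (abs_nonneg _) hρ0
      _ = _ := by rw [Real.norm_eq_abs, sq_abs]; ring
  rw [Finset.sum_add_distrib, ← Finset.mul_sum, ← EuclideanSpace.norm_sq_eq] at h3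
  simp only [Finset.sum_const, Finset.card_univ, Fintype.card_fin, nsmul_eq_mul] at h3
  have h4 : ‖x‖ ^ 2 ≤ Λ * gradientEnergy n x := by
    have := norm_sq_le_gradientEnergy n x
    rw [hΛ]
    linarith
  have h5 : ρ * A ≤ c / (4 * Λ) := by
    rw [le_div_iff₀ (by positivity)]
    linarith
  have h6 : c / (4 * Λ) * ‖x‖ ^ 2 ≤ c / 4 * gradientEnergy n x := by
    calc c / (4 * Λ) * ‖x‖ ^ 2 ≤ c / (4 * Λ) * (Λ * gradientEnergy n x) := by gcongr
      _ = _ := by field_simp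
  have h7 := mul_le_mul_of_nonneg_right h5 (sq_nonneg ‖x‖)
  linarith

/-- **Theorem 2.1.** Let `K : [0,∞) → ℝ` and `f₁,…,f_n : ℝ → ℝ` be continuous functions with
(a) `inf_{t>0} ∫₀ᵗ K < 0` and `liminf_{t→+∞} (∫₀ᵗ K)/t > 0`;
(b) `limsup_{|t|→+∞} |∫₀ᵗ f_k|/t² < +∞`;
(c) `t ↦ ∫₀ᵗ f_k` odd, vanishing only at `0`.
Then for each `r > 0` there is `δ > 0` such that for all continuous `g₁,…,g_n` with
`max_k (sup ∫₀ᵗ g_k − inf ∫₀ᵗ g_k) < δ` there is `μ ∈ ℝⁿ`, `Σ|μ_k|² < r²`, for which the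
nonlocal discrete problem has at least three solutions `x ∈ ℝ^{n+2}`, `x₀ = x_{n+1} = 0`. -/
theorem ricceri_main (n : ℕ) (hn : 1 ≤ n) (K : ℝ → ℝ) (f : Fin n → ℝ → ℝ)
    (hK : ContinuousOn K (Set.Ici 0)) (hf : ∀ k, Continuous (f k))
    (ha1 : (⨅ t ∈ Set.Ioi (0 : ℝ), ((∫ s in (0 : ℝ)..t, K s : ℝ) : EReal)) < 0)
    (ha2 : 0 < Filter.liminf
      (fun t : ℝ => (((∫ s in (0 : ℝ)..t, K s) / t : ℝ) : EReal)) atTop)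
    (hb : ∀ k, Filter.limsup
      (fun t : ℝ => ((|∫ s in (0 : ℝ)..t, f k s| / t ^ 2 : ℝ) : EReal)) (atBot ⊔ atTop) < ⊤)
    (hodd : ∀ k, ∀ t : ℝ, (∫ s in (0 : ℝ)..(-t), f k s) = -∫ s in (0 : ℝ)..t, f k s)
    (hvan : ∀ k, ∀ t : ℝ, (∫ s in (0 : ℝ)..t, f k s) = 0 → t = 0) :
    ∀ r > (0 : ℝ), ∃ δ > (0 : ℝ), ∀ g : Fin n → ℝ → ℝ, (∀ k, Continuous (g k)) →
      (∀ k, BddAbove (Set.range fun t : ℝ => ∫ s in (0 : ℝ)..t, g k s)) →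
      (∀ k, BddBelow (Set.range fun t : ℝ => ∫ s in (0 : ℝ)..t, g k s)) →
      (∀ k, (⨆ t : ℝ, ∫ s in (0 : ℝ)..t, g k s) - (⨅ t : ℝ, ∫ s in (0 : ℝ)..t, g k s) < δ) →
      ∃ μ : Fin n → ℝ, (∑ k, |μ k| ^ 2 < r ^ 2) ∧
        ∃ x₁ x₂ x₃ : Fin (n + 2) → ℝ, x₁ ≠ x₂ ∧ x₁ ≠ x₃ ∧ x₂ ≠ x₃ ∧
          ∀ x ∈ ({x₁, x₂, x₃} : Set (Fin (n + 2) → ℝ)),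
            x 0 = 0 ∧ x (Fin.last (n + 1)) = 0 ∧
            ∀ k : Fin n,
              -(K (∑ h : Fin (n + 1), |x h.succ - x h.castSucc| ^ 2) *
                  (x k.succ.succ - 2 * x k.succ.castSucc + x k.castSucc.castSucc)) =
                g k (x k.succ.castSucc) + μ k * f k (x k.succ.castSucc) := by
  intro r hr
  -- a continuous extension of `K` to the whole line
  set K' : ℝ → ℝ := fun t => K (max t 0) with hK'
  have hK'c : Continuous K' :=
    hK.comp_continuous (by fun_prop) fun t => le_max_right t 0
  have hK'eq : ∀ t ≥ 0, K' t = K t := fun t ht => by simp [hK', max_eq_left ht]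
  set P : ℝ → ℝ := fun t => ∫ s in (0 : ℝ)..t, K' s with hP
  have hPc : Continuous P := intervalIntegral.continuous_primitive
    (fun a b => hK'c.intervalIntegrable a b) 0
  have hPeq : ∀ t ≥ 0, P t = ∫ s in (0 : ℝ)..t, K s := fun t ht => by
    refine intervalIntegral.integral_congr fun s hs => hK'eq s ?_
    rw [Set.uIcc_of_le ht] at hs
    exact hs.1
  obtain ⟨t₁, ht₁, hPt₁⟩ : ∃ t₁ > 0, P t₁ < 0 := by
    obtain ⟨t, ht⟩ := iInf_lt_iff.1 ha1
    obtain ⟨ht0, ht⟩ := iInf_lt_iff.1 ht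
    exact ⟨t, ht0, by rw [hPeq t (le_of_lt ht0)]; exact_mod_cast ht⟩
  obtain ⟨c, hc, b, hlow⟩ : ∃ c > 0, ∃ b, ∀ t ≥ 0, c * t - b ≤ P t := by
    refine exists_linear_lower_bound hPc (ha2.trans_eq (liminf_congr ?_))
    filter_upwards [eventually_ge_atTop 0] with t ht
    rw [hPeq t ht]
  obtain ⟨t₀, ht₀, hPt₀, hPmin⟩ := exists_min_on_nonneg hPc (by simp [hP]) ht₁ hPt₁ hc hlow
  set F : Fin n → ℝ → ℝ := fun k t => ∫ s in (0 : ℝ)..t, f k s with hF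
  have hFc : ∀ k, Continuous (F k) := fun k => intervalIntegral.continuous_primitive
    (fun a b => (hf k).intervalIntegrable a b) 0
  have hF0 : ∀ k, F k 0 = 0 := fun k => by simp [hF]
  obtain ⟨A, -, B, -, hFAB⟩ := exists_uniform_quadratic_upper_bound hFc hb
  obtain ⟨ρ, hρ, hρr, hρA⟩ : ∃ ρ > 0, n * ρ ^ 2 < r ^ 2 ∧
      ρ * A * (n * (n + 2) ^ 2 + 1) ≤ c / 4 := by
    have h0 : ∀ᶠ ρ : ℝ in nhdsWithin 0 (Set.Ioi 0), 0 < ρ := self_mem_nhdsWithin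
    have h1 : Tendsto (fun ρ : ℝ => n * ρ ^ 2) (nhdsWithin 0 (Set.Ioi 0)) (nhds 0) :=
      tendsto_nhdsWithin_of_tendsto_nhds (Continuous.tendsto' (by fun_prop) _ _ (by simp))
    have h2 : Tendsto (fun ρ : ℝ => ρ * A * (n * (n + 2) ^ 2 + 1))
        (nhdsWithin 0 (Set.Ioi 0)) (nhds 0) :=
      tendsto_nhdsWithin_of_tendsto_nhds (Continuous.tendsto' (by fun_prop) _ _ (by simp))
    exact (h0.and ((h1.eventually_lt_const (by positivity)).and
      (h2.eventually_le_const (by positivity)))).exists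
  choose s hs hs1 hs2 using fun k : Fin n => exists_single_gradientEnergy_eq n k ht₀
  have : Nonempty (Fin n) := ⟨⟨0, hn⟩⟩
  obtain ⟨β, hβ, hβF⟩ : ∃ β > 0, ∀ k, β ≤ |F k (s k)| := by
    obtain ⟨k, hk⟩ := Finite.exists_min fun k => |F k (s k)|
    exact ⟨_, abs_pos.2 fun h => (hs k).ne' (hvan k _ h), hk⟩
  have hpoint : ∀ (μ : Fin n → ℝ) (k : Fin n), ∃ x : EuclideanSpace ℝ (Fin n),
      gradientEnergy n x = t₀ ∧ |μ k| * β ≤ ∑ j, μ j * F j (x j) := by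
    intro μ k
    have hsum : ∀ u, ∑ j, μ j * F j ((EuclideanSpace.single k u : EuclideanSpace ℝ (Fin n)) j) =
        μ k * F k u := by
      intro u
      rw [Finset.sum_eq_single k]
      · simp
      · intro j _ hj
        simp [hj, hF0]
      · simp
    have habs : |μ k| * β ≤ |μ k * F k (s k)| := by
      rw [abs_mul]
      gcongr
      exact hβF k
    rcases le_total 0 (μ k * F k (s k)) with h | h
    · refine ⟨_, hs1 k, ?_⟩
      rwa [hsum, ← abs_of_nonneg h]
    · refine ⟨_, hs2 k, ?_⟩
      rw [hsum, show F k (-s k) = -F k (s k) from hodd k _, mul_neg, ← abs_of_nonpos h]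
      exact habs
  have hn0 : (0 : ℝ) < n := by exact_mod_cast hn
  refine ⟨min (ρ * β) (-P t₀ / 2) / n, div_pos (lt_min (by positivity) (by linarith)) hn0, ?_⟩
  intro g hg hgA hgB hgδ
  set G : Fin n → ℝ → ℝ := fun k t => ∫ s in (0 : ℝ)..t, g k s with hG
  have hGc : ∀ k, Continuous (G k) := fun k => intervalIntegral.continuous_primitive
    (fun a b => (hg k).intervalIntegrable a b) 0
  set M : Fin n → ℝ := fun k => ⨆ t, G k t
  set m : Fin n → ℝ := fun k => ⨅ t, G k t
  have hGM : ∀ k t, G k t ≤ M k := fun k t => le_ciSup (hgA k) t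
  have hGm : ∀ k t, m k ≤ G k t := fun k t => ciInf_le (hgB k) t
  have hosc : ∑ k, M k - ∑ k, m k < min (ρ * β) (-P t₀ / 2) := by
    rw [← Finset.sum_sub_distrib]
    refine (Finset.sum_lt_sum_of_nonempty Finset.univ_nonempty fun k _ => hgδ k).trans_eq ?_
    simp only [Finset.sum_const, Finset.card_univ, Fintype.card_fin, nsmul_eq_mul]
    field_simp
  have hosc1 := hosc.trans_le (min_le_left _ _)
  have hosc2 := hosc.trans_le (min_le_right _ _)
  have hGMs : ∀ x : EuclideanSpace ℝ (Fin n), ∑ k, G k (x k) ≤ ∑ k, M k := fun x =>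
    Finset.sum_le_sum fun k _ => hGM k _
  have hGms : ∀ x : EuclideanSpace ℝ (Fin n), ∑ k, m k ≤ ∑ k, G k (x k) := fun x =>
    Finset.sum_le_sum fun k _ => hGm k _
  have hM0 : 0 ≤ ∑ k, M k := by
    simpa [hG] using hGMs 0
  obtain ⟨a, ha, d, hcoer⟩ := exists_coercive_bound n hc hlow hFAB hρA hGM
  set I : EuclideanSpace ℝ (Fin n) → ℝ := fun x =>
    P (gradientEnergy n x) / 2 - ∑ k, G k (x k) with hI
  have hEc := continuous_gradientEnergy n
  have hIc : Continuous I := by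
    simp only [hI]
    fun_prop
  have hI0 : I 0 = 0 := by
    have : gradientEnergy n 0 = 0 := by simp [gradientEnergy]
    simp [hI, this, hP, hG]
  obtain ⟨μ, hμ, p, q, hpq, hp, hq⟩ := exists_two_minimizers (Φ := fun k x => F k (x k)) hIc
    (fun k => by fun_prop) hρ
    (isCompact_closedBall (0 : EuclideanSpace ℝ (Fin n)) (Real.sqrt (|d| / a)))
    (Metric.mem_closedBall_self (Real.sqrt_nonneg _)) (fun μ hμ x hx => by
      rw [mem_closedBall_zero_iff, not_le] at hx
      replace hx := Real.lt_sq_of_sqrt_lt hx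
      rw [div_lt_iff₀ ha] at hx
      have h1 := hcoer μ hμ x
      have h2 := le_abs_self d
      simp only [hI0, PiLp.zero_apply, hF0, mul_zero, Finset.sum_const_zero, sub_zero]
      simp only [hI]
      linarith)
    (fun μ hμ => by
      obtain ⟨k, hk⟩ : ∃ k, ρ ≤ |μ k| := by
        by_contra! h
        exact absurd hμ ((pi_norm_lt_iff hρ).2 h).ne
      obtain ⟨x, hx, hxk⟩ := hpoint μ k
      refine ⟨x, fun y => ?_⟩
      have h1 := hPmin _ (gradientEnergy_nonneg n y)
      have h2 := mul_le_mul_of_nonneg_right hk hβ.le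
      have h3 := hGMs y
      have h4 := hGms x
      simp only [hI, hx]
      linarith)
    (fun μ _ z hz => by
      obtain ⟨x, hx, hxk⟩ := hpoint μ ⟨0, hn⟩
      have hz0 : z = 0 := by
        ext k
        exact hvan k _ (hz k)
      refine ⟨x, ?_⟩
      have h1 : 0 ≤ |μ ⟨0, hn⟩| * β := by positivity
      have h4 := hGms x
      simp only [hz0, hI0, PiLp.zero_apply, hF0, mul_zero, Finset.sum_const_zero, sub_zero]
      simp only [hI, hx]
      linarith)
  -- the energy functional for the multiplier `μ`
  have hcomb : ∀ k, Continuous fun t => g k t + μ k * f k t := fun k =>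
    (hg k).add ((hf k).const_mul _)
  have hJ : (fun x : EuclideanSpace ℝ (Fin n) => (∫ s in (0 : ℝ)..gradientEnergy n x, K' s) / 2
      - ∑ k, ∫ s in (0 : ℝ)..x k, (g k s + μ k * f k s)) =
      fun x => I x - ∑ k, μ k * F k (x k) := by
    ext x
    simp only [hI, hP, hG, hF]
    rw [sub_sub, ← Finset.sum_add_distrib]
    congr 1
    refine Finset.sum_congr rfl fun k _ => ?_
    rw [intervalIntegral.integral_add ((hg k).intervalIntegrable _ _)
      (((hf k).const_mul _).intervalIntegrable _ _), intervalIntegral.integral_const_mul]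
  have hgrad := hasGradientAt_energy n hK'c hcomb
  rw [hJ] at hgrad
  have hJcoer : Tendsto (fun x => I x - ∑ k, μ k * F k (x k))
      (cocompact (EuclideanSpace ℝ (Fin n))) atTop := by
    refine tendsto_atTop_mono (fun x => hcoer μ hμ.le x) ?_
    refine tendsto_atTop_add_const_right _ _ (Tendsto.const_mul_atTop ha ?_)
    exact (tendsto_pow_atTop two_ne_zero).comp tendsto_norm_cocompact_atTop
  obtain ⟨z, hzp, hzq, hz⟩ := exists_third_critical_point hgrad
    (continuous_gradient_energy n hK'c hcomb) hJcoer hpq hp hq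
  have hsol : ∀ x : EuclideanSpace ℝ (Fin n), WithLp.toLp 2 (fun k =>
      -(K' (gradientEnergy n x) * (zeroExtend n x k.succ.succ
        - 2 * zeroExtend n x k.succ.castSucc + zeroExtend n x k.castSucc.castSucc))
        - (g k (x k) + μ k * f k (x k))) = 0 →
      zeroExtend n x 0 = 0 ∧ zeroExtend n x (Fin.last (n + 1)) = 0 ∧ ∀ k : Fin n,
        -(K (∑ h : Fin (n + 1), |zeroExtend n x h.succ - zeroExtend n x h.castSucc| ^ 2) *
          (zeroExtend n x k.succ.succ - 2 * zeroExtend n x k.succ.castSucc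
            + zeroExtend n x k.castSucc.castSucc)) =
        g k (zeroExtend n x k.succ.castSucc) + μ k * f k (zeroExtend n x k.succ.castSucc) := by
    intro x hx
    refine ⟨zeroExtend_zero n x, zeroExtend_last n x, fun k => ?_⟩
    have hE : ∑ h : Fin (n + 1), |zeroExtend n x h.succ - zeroExtend n x h.castSucc| ^ 2 =
        gradientEnergy n x := by
      simp only [gradientEnergy, forwardDiff_apply, sq_abs]
    have h := congrArg (fun v : EuclideanSpace ℝ (Fin n) => v k) hx
    simp only [PiLp.zero_apply] at h
    rw [hE, ← hK'eq _ (gradientEnergy_nonneg n x), zeroExtend_succ_castSucc n x k]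
    rw [zeroExtend_succ_castSucc n x k] at h
    exact sub_eq_zero.1 h
  have hcritmin : ∀ x, (∀ y, I x - ∑ k, μ k * F k (x k) ≤ I y - ∑ k, μ k * F k (y k)) →
      WithLp.toLp 2 (fun k => -(K' (gradientEnergy n x) * (zeroExtend n x k.succ.succ
        - 2 * zeroExtend n x k.succ.castSucc + zeroExtend n x k.castSucc.castSucc))
        - (g k (x k) + μ k * f k (x k))) = 0 := fun x hx => by
    have hloc : IsLocalMin (fun x => I x - ∑ k, μ k * F k (x k)) x := Eventually.of_forall hx
    have h := hloc.hasFDerivAt_eq_zero (hgrad x).hasFDerivAt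
    simpa only [map_eq_zero_iff _ (InnerProductSpace.toDual ℝ _).injective] using h
  have hinj := zeroExtend_injective n
  refine ⟨μ, ?_, zeroExtend n p, zeroExtend n q, zeroExtend n z, hinj.ne hpq, hinj.ne hzp.symm,
    hinj.ne hzq.symm, ?_⟩
  · calc ∑ k, |μ k| ^ 2 ≤ ∑ _k : Fin n, ρ ^ 2 := by
          refine Finset.sum_le_sum fun k _ => ?_
          have : |μ k| ≤ ρ := (norm_le_pi_norm μ k).trans hμ.le
          gcongr
      _ = n * ρ ^ 2 := by simp
      _ < r ^ 2 := hρr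
  · rintro x (rfl | rfl | rfl)
    · exact hsol p (hcritmin p hp)
    · exact hsol q (hcritmin q hq)
    · exact hsol z hz
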